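/- Analytic capacity is subadditive, i.e. γ(E ∪ F) ≤ γ(E) + γ(F) for all compact sets E, F ⊆ ℂ, if and only if the inequality γ(E ∪ F) ≤ γ(E) + γ(F) holds for all disjoint compact sets E and F such that each of E and F is a finite union of pairwise disjoint closed disks and all of the disks occurring in E ∪ F have one and the same radius. -/

import Mathlib

open Complex Filter Metric Set Topology Bornology MeasureTheory

noncomputable section

/-- `f` has value `l` at infinity and derivative `w` at infinity (within the set `s`), i.e.
`f(z) → l` and `z (f(z) - l) → w` as `z → ∞` within `s`. -/
def HasDerivAtInftyOn (f : ℂ → ℂ) (s : Set ℂ) (l w : ℂ) : Prop :=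
  Tendsto f (cobounded ℂ ⊓ 𝓟 s) (𝓝 l) ∧
    Tendsto (fun z => z * (f z - l)) (cobounded ℂ ⊓ 𝓟 s) (𝓝 w)

/-- The analytic capacity of a plane set `K`:
`γ(K) = sup { |f′(∞)| : f` holomorphic on `ℂ∞ ∖ K`, `‖f‖ ≤ 1 }`. -/
def analyticCapacity (K : Set ℂ) : ℝ :=
  sSup { r : ℝ | ∃ (f : ℂ → ℂ) (l w : ℂ),
    DifferentiableOn ℂ f Kᶜ ∧ (∀ z ∈ Kᶜ, ‖f z‖ ≤ 1) ∧
    HasDerivAtInftyOn f Kᶜ l w ∧ r = ‖w‖ }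


/-! ### Behaviour at infinity -/

theorem infty_expansion {R : ℝ} (hR : 0 < R) {f : ℂ → ℂ}
    (hd : DifferentiableOn ℂ f {z | R < ‖z‖}) (hb : ∀ z, R < ‖z‖ → ‖f z‖ ≤ 1) :
    ∃ l w : ℂ, ‖l‖ ≤ 1 ∧ ‖w‖ ≤ 2 * R ∧
      ∀ z, R < ‖z‖ → ‖z * (f z - l) - w‖ ≤ 4 * R ^ 2 / ‖z‖ := by
  have hRi : 0 < R⁻¹ := inv_pos.2 hR
  have hs : ball (0 : ℂ) R⁻¹ ∈ 𝓝 (0 : ℂ) := ball_mem_nhds _ hRi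
  have key : ∀ ζ : ℂ, ζ ∈ ball (0 : ℂ) R⁻¹ \ {0} → R < ‖ζ⁻¹‖ := by
    rintro ζ ⟨h1, h2⟩
    simp only [mem_ball_zero_iff, mem_singleton_iff] at h1 h2
    rw [norm_inv]
    exact (lt_inv_comm₀ (norm_pos_iff.2 h2) hR).1 h1
  set g0 : ℂ → ℂ := fun ζ => f ζ⁻¹ with hg0
  have hd0 : DifferentiableOn ℂ g0 (ball (0 : ℂ) R⁻¹ \ {0}) := by
    refine DifferentiableOn.comp (t := {z | R < ‖z‖}) hd ?_ (fun ζ hζ => key ζ hζ)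
    exact differentiableOn_inv.mono (fun x hx => by simpa using hx.2)
  have hbd : ∀ ζ ∈ ball (0 : ℂ) R⁻¹ \ {0}, ‖g0 ζ‖ ≤ 1 := fun ζ hζ => hb _ (key ζ hζ)
  have hg := differentiableOn_update_limUnder_of_bddAbove hs hd0
    ⟨1, by rintro _ ⟨ζ, hζ, rfl⟩; exact hbd ζ hζ⟩
  set g := Function.update g0 0 (limUnder (𝓝[≠] 0) g0) with hgdef
  have hgne : ∀ ζ, ζ ≠ 0 → g ζ = f ζ⁻¹ := fun ζ h => by simp [hgdef, h, hg0]
  have hgc : ContinuousAt g 0 := (hg.differentiableAt hs).continuousAt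
  have hg1 : ‖g 0‖ ≤ 1 := by
    have h1 : Tendsto (fun ζ => ‖g ζ‖) (𝓝[≠] 0) (𝓝 ‖g 0‖) :=
      (hgc.norm.tendsto).mono_left nhdsWithin_le_nhds
    refine le_of_tendsto h1 ?_
    have : ball (0 : ℂ) R⁻¹ \ {0} ∈ 𝓝[≠] (0 : ℂ) := by
      rw [sdiff_eq]; exact inter_mem (nhdsWithin_le_nhds hs) self_mem_nhdsWithin
    filter_upwards [this] with ζ hζ
    rw [hgne ζ (by simpa using hζ.2)]
    exact hbd ζ hζ
  have hgb : ∀ ζ ∈ ball (0 : ℂ) R⁻¹, ‖g ζ‖ ≤ 1 := by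
    intro ζ hζ
    by_cases h : ζ = 0
    · rw [h]; exact hg1
    · rw [hgne ζ h]; exact hbd ζ ⟨hζ, by simpa using h⟩
  have hm : MapsTo g (ball 0 R⁻¹) (closedBall (g 0) 2) := by
    intro ζ hζ
    rw [mem_closedBall, dist_eq_norm]
    linarith [norm_sub_le (g ζ) (g 0), hgb ζ hζ]
  set h := dslope g 0 with hh
  have hhb : ∀ ζ ∈ ball (0 : ℂ) R⁻¹, ‖h ζ‖ ≤ 2 * R := by
    intro ζ hζ
    have := norm_dslope_le_div_of_mapsTo_ball hg hm hζ
    simpa [div_eq_mul_inv] using this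
  have hhd : DifferentiableOn ℂ h (ball 0 R⁻¹) := (differentiableOn_dslope hs).2 hg
  have hm2 : MapsTo h (ball 0 R⁻¹) (closedBall (h 0) (4 * R)) := by
    intro ζ hζ
    rw [mem_closedBall, dist_eq_norm]
    linarith [norm_sub_le (h ζ) (h 0), hhb ζ hζ, hhb 0 (mem_ball_self hRi)]
  refine ⟨g 0, h 0, hg1, hhb 0 (mem_ball_self hRi), fun z hz => ?_⟩
  have hz0 : z ≠ 0 := norm_pos_iff.1 (hR.trans hz)
  have hzi : z⁻¹ ∈ ball (0 : ℂ) R⁻¹ := by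
    rw [mem_ball_zero_iff, norm_inv]
    exact inv_strictAnti₀ hR hz
  have h3 := norm_dslope_le_div_of_mapsTo_ball hhd hm2 hzi
  have hzi0 : z⁻¹ ≠ 0 := inv_ne_zero hz0
  rw [dslope_of_ne _ hzi0, slope_def_field] at h3
  have h4 : h z⁻¹ = z * (f z - g 0) := by
    rw [hh, dslope_of_ne _ hzi0, slope_def_field, hgne _ hzi0, inv_inv]
    field_simp
    simp
  rw [h4, sub_zero, div_inv_eq_mul, norm_mul] at h3
  rw [le_div_iff₀ (norm_pos_iff.2 hz0)]
  calc _ ≤ _ := h3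
    _ = _ := by rw [div_inv_eq_mul]; ring

theorem hasDerivAtInftyOn_of_bound {R C : ℝ} {f : ℂ → ℂ} {l w : ℂ} (s : Set ℂ)
    (h : ∀ z, R < ‖z‖ → ‖z * (f z - l) - w‖ ≤ C / ‖z‖) : HasDerivAtInftyOn f s l w := by
  have hn : Tendsto (fun z : ℂ => ‖z‖) (cobounded ℂ) atTop := tendsto_norm_cobounded_atTop
  have h2 : Tendsto (fun z => z * (f z - l)) (cobounded ℂ) (𝓝 w) := by
    rw [tendsto_iff_norm_sub_tendsto_zero]
    refine squeeze_zero' (Eventually.of_forall fun _ => norm_nonneg _) ?_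
      (hn.const_div_atTop C)
    filter_upwards [hn.eventually_gt_atTop R] with z hz using h z hz
  refine ⟨?_, h2.mono_left inf_le_left⟩
  refine Tendsto.mono_left ?_ inf_le_left
  have h3 : Tendsto (fun z : ℂ => z⁻¹ * (z * (f z - l)) + l) (cobounded ℂ) (𝓝 (0 * w + l)) :=
    (tendsto_inv₀_cobounded.mul h2).add_const l
  rw [zero_mul, zero_add] at h3
  refine h3.congr' ?_
  filter_upwards [hn.eventually_gt_atTop 0] with z hz
  have : z ≠ 0 := norm_pos_iff.1 hz
  field_simp
  ring

theorem neBot_cobounded_compl {K : Set ℂ} (hK : IsBounded K) :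
    (cobounded ℂ ⊓ 𝓟 Kᶜ).NeBot := by
  have : Kᶜ ∈ cobounded ℂ := isBounded_def.1 hK
  rw [inf_eq_left.2 (le_principal_iff.2 this)]
  infer_instance

theorem HasDerivAtInftyOn.unique {K : Set ℂ} (hK : IsBounded K) {f : ℂ → ℂ} {l w l' w' : ℂ}
    (h : HasDerivAtInftyOn f Kᶜ l w) (h' : HasDerivAtInftyOn f Kᶜ l' w') : l = l' ∧ w = w' := by
  have := neBot_cobounded_compl hK
  have e : l = l' := tendsto_nhds_unique h.1 h'.1
  subst e
  exact ⟨rfl, tendsto_nhds_unique h.2 h'.2⟩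

def Adm (K : Set ℂ) (f : ℂ → ℂ) (l w : ℂ) : Prop :=
  DifferentiableOn ℂ f Kᶜ ∧ (∀ z ∈ Kᶜ, ‖f z‖ ≤ 1) ∧ HasDerivAtInftyOn f Kᶜ l w

theorem Adm.expansion {K : Set ℂ} {R : ℝ} (hR : 0 < R) (hK : K ⊆ closedBall 0 R)
    {f : ℂ → ℂ} {l w : ℂ} (h : Adm K f l w) :
    ‖l‖ ≤ 1 ∧ ‖w‖ ≤ 2 * R ∧ ∀ z, R < ‖z‖ → ‖z * (f z - l) - w‖ ≤ 4 * R ^ 2 / ‖z‖ := by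
  have hsub : ∀ z : ℂ, R < ‖z‖ → z ∈ Kᶜ := fun z hz hzK => by
    have := hK hzK
    simp at this
    linarith
  obtain ⟨l', w', h1, h2, h3⟩ := infty_expansion hR (h.1.mono (fun z hz => hsub z hz))
    (fun z hz => h.2.1 z (hsub z hz))
  obtain ⟨rfl, rfl⟩ := h.2.2.unique (isBounded_closedBall.subset hK)
    (hasDerivAtInftyOn_of_bound _ h3)
  exact ⟨h1, h2, h3⟩

theorem bddAbove_cap {K : Set ℂ} (hK : IsBounded K) : BddAbove { r : ℝ | ∃ (f : ℂ → ℂ) (l w : ℂ),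
    DifferentiableOn ℂ f Kᶜ ∧ (∀ z ∈ Kᶜ, ‖f z‖ ≤ 1) ∧
    HasDerivAtInftyOn f Kᶜ l w ∧ r = ‖w‖ } := by
  obtain ⟨R, hR, hKR⟩ := hK.subset_closedBall_lt 0 0
  refine ⟨2 * R, ?_⟩
  rintro r ⟨f, l, w, h1, h2, h3, rfl⟩
  exact (Adm.expansion hR hKR ⟨h1, h2, h3⟩).2.1

theorem Adm.le_cap {K : Set ℂ} (hK : IsBounded K) {f : ℂ → ℂ} {l w : ℂ} (h : Adm K f l w) :
    ‖w‖ ≤ analyticCapacity K :=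
  le_csSup (bddAbove_cap hK) ⟨f, l, w, h.1, h.2.1, h.2.2, rfl⟩

theorem nonempty_cap (K : Set ℂ) : { r : ℝ | ∃ (f : ℂ → ℂ) (l w : ℂ),
    DifferentiableOn ℂ f Kᶜ ∧ (∀ z ∈ Kᶜ, ‖f z‖ ≤ 1) ∧
    HasDerivAtInftyOn f Kᶜ l w ∧ r = ‖w‖ }.Nonempty :=
  ⟨0, fun _ => 0, 0, 0, by fun_prop, by simp, ⟨tendsto_const_nhds, by simpa using tendsto_const_nhds⟩, by simp⟩

theorem cap_le {K : Set ℂ} {c : ℝ} (h : ∀ f l w, Adm K f l w → ‖w‖ ≤ c) :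
    analyticCapacity K ≤ c := by
  refine csSup_le (nonempty_cap K) ?_
  rintro r ⟨f, l, w, h1, h2, h3, rfl⟩
  exact h f l w ⟨h1, h2, h3⟩

theorem Adm.mono {K L : Set ℂ} (hKL : K ⊆ L) {f : ℂ → ℂ} {l w : ℂ} (h : Adm K f l w) :
    Adm L f l w := by
  have hc := compl_subset_compl.2 hKL
  have hf : cobounded ℂ ⊓ 𝓟 Lᶜ ≤ cobounded ℂ ⊓ 𝓟 Kᶜ := inf_le_inf_left _ (principal_mono.2 hc)
  exact ⟨h.1.mono hc, fun z hz => h.2.1 z (hc hz), h.2.2.1.mono_left hf, h.2.2.2.mono_left hf⟩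

theorem cap_mono {K L : Set ℂ} (hL : IsBounded L) (hKL : K ⊆ L) :
    analyticCapacity K ≤ analyticCapacity L :=
  cap_le fun _ _ _ h => (h.mono hKL).le_cap hL

theorem exists_adm_of_lt {K : Set ℂ} {c : ℝ} (h : c < analyticCapacity K) :
    ∃ f l w, Adm K f l w ∧ c < ‖w‖ := by
  by_contra! hcon
  exact absurd (cap_le hcon) (not_le.2 h)

theorem cap_nonneg {K : Set ℂ} (hK : IsBounded K) : 0 ≤ analyticCapacity K := by
  have : Adm K (fun _ => 0) 0 0 :=
    ⟨by fun_prop, by simp, ⟨tendsto_const_nhds, by simpa using tendsto_const_nhds⟩⟩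
  simpa using this.le_cap hK

/-! ### Outer regularity of analytic capacity -/

theorem exists_ultralim (U : Ultrafilter ℕ) {a : ℕ → ℂ} {C : ℝ}
    (h : ∀ᶠ n in (U : Filter ℕ), ‖a n‖ ≤ C) : ∃ b, Tendsto a U (𝓝 b) := by
  have hc : IsCompact (closedBall (0 : ℂ) C) := isCompact_closedBall _ _
  obtain ⟨b, -, hb⟩ := hc.ultrafilter_le_nhds (U.map a) (by
    rw [le_principal_iff]
    exact h.mono fun n hn => by simpa using hn)
  exact ⟨b, hb⟩

theorem cap_outer {K : Set ℂ} (hK : IsCompact K) {η : ℝ} (hη : 0 < η) :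
    ∃ ε > 0, analyticCapacity (cthickening ε K) ≤ analyticCapacity K + η := by
  by_contra! hcon
  have hpos : ∀ n : ℕ, (0 : ℝ) < 1 / ((n : ℝ) + 1) := fun n => Nat.one_div_pos_of_nat
  choose f l w hadm hw using fun n : ℕ => exists_adm_of_lt (hcon (1 / ((n : ℝ) + 1)) (hpos n))
  obtain ⟨R₀, hR₀, hKR₀⟩ := hK.isBounded.subset_closedBall_lt 0 0
  set R := R₀ + 1 with hRdef
  have hR : 0 < R := by positivity
  have hKR : ∀ n : ℕ, cthickening (1 / ((n : ℝ) + 1)) K ⊆ closedBall 0 R := by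
    intro n z hz
    rw [mem_closedBall_zero_iff]
    have h1 : (1 : ℝ) / ((n : ℝ) + 1) ≤ 1 := by
      rw [div_le_one (by positivity)]; linarith [Nat.cast_nonneg (α := ℝ) n]
    have h2 := cthickening_subset_of_subset (1 / ((n : ℝ) + 1)) hKR₀ hz
    rw [cthickening_closedBall (hpos n).le hR₀.le, mem_closedBall_zero_iff] at h2
    linarith
  have hexp := fun n => (hadm n).expansion hR (hKR n)
  let U : Ultrafilter ℕ := hyperfilter ℕ
  have hU : (U : Filter ℕ) ≤ atTop := Nat.hyperfilter_le_atTop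
  obtain ⟨l', hl'⟩ := exists_ultralim U (a := l) (C := 1) (Eventually.of_forall fun n => (hexp n).1)
  obtain ⟨w', hw'⟩ := exists_ultralim U (a := w) (C := 2 * R)
    (Eventually.of_forall fun n => (hexp n).2.1)
  have hsep : ∀ z ∈ Kᶜ, ∃ ρ > 0, ∀ᶠ n : ℕ in (U : Filter ℕ),
      ball z (3 * ρ) ⊆ (cthickening (1 / ((n : ℝ) + 1)) K)ᶜ := by
    intro z hz
    obtain ⟨d, hd, hdK⟩ := Metric.isOpen_iff.1 hK.isClosed.isOpen_compl z hz
    refine ⟨d / 6, by positivity, ?_⟩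
    have h1 : ∀ᶠ n : ℕ in atTop, 1 / ((n : ℝ) + 1) < d / 2 :=
      tendsto_one_div_add_atTop_nhds_zero_nat.eventually_lt_const (by positivity)
    refine (h1.filter_mono hU).mono ?_
    intro n hn y hy hyK
    have h3 := cthickening_subset_thickening' (by positivity : 0 < d / 2) hn K hyK
    obtain ⟨x, hx, hxy⟩ := mem_thickening_iff.1 h3
    refine hdK (?_ : x ∈ ball z d) hx
    rw [mem_ball] at hy ⊢
    have := dist_triangle_left x z y
    linarith [dist_comm y x]
  have hptb : ∀ z ∈ Kᶜ, ∀ᶠ n : ℕ in (U : Filter ℕ), ‖f n z‖ ≤ 1 := by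
    intro z hz
    obtain ⟨ρ, hρ, h⟩ := hsep z hz
    exact h.mono fun n hn => (hadm n).2.1 z (hn (mem_ball_self (by positivity)))
  have hF : ∀ z, ∃ b, z ∈ Kᶜ → Tendsto (fun n => f n z) U (𝓝 b) := by
    intro z
    by_cases hz : z ∈ Kᶜ
    · obtain ⟨b, hb⟩ := exists_ultralim U (hptb z hz)
      exact ⟨b, fun _ => hb⟩
    · exact ⟨0, fun h => absurd h hz⟩
  choose F hF using hF
  have hlu : TendstoLocallyUniformlyOn f F U Kᶜ := by
    rw [Metric.tendstoLocallyUniformlyOn_iff]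
    intro e he z hz
    obtain ⟨ρ, hρ, hev⟩ := hsep z hz
    have hlip : ∀ᶠ n : ℕ in (U : Filter ℕ), ∀ y ∈ ball z ρ,
        dist (f n y) (f n z) ≤ ρ⁻¹ * dist y z := by
      refine hev.mono fun n hn y hy => ?_
      have hsub : ball z (2 * ρ) ⊆ (cthickening (1 / ((n : ℝ) + 1)) K)ᶜ :=
        (ball_subset_ball (by linarith)).trans hn
      have := dist_le_div_mul_dist_of_mapsTo_ball (f := f n) (c := z) (R₁ := 2 * ρ) (R₂ := 2)
        (z := y) ((hadm n).1.mono hsub) (fun x hx => by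
          rw [mem_closedBall, dist_eq_norm]
          linarith [norm_sub_le (f n x) (f n z), (hadm n).2.1 x (hsub hx),
            (hadm n).2.1 z (hsub (mem_ball_self (by positivity)))])
        (ball_subset_ball (by linarith) hy)
      calc _ ≤ _ := this
        _ = _ := by field_simp
    have hballK : ball z ρ ⊆ Kᶜ := by
      obtain ⟨n, hn⟩ := hev.exists
      exact ((ball_subset_ball (by linarith)).trans hn).trans
        (compl_subset_compl.2 (self_subset_cthickening _))
    have hlipF : ∀ y ∈ ball z ρ, dist (F y) (F z) ≤ ρ⁻¹ * dist y z := by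
      intro y hy
      exact le_of_tendsto ((hF y (hballK hy)).dist (hF z hz)) (hlip.mono fun n hn => hn y hy)
    refine ⟨ball z (min ρ (ρ * (e / 3))), nhdsWithin_le_nhds (ball_mem_nhds _ (by positivity)), ?_⟩
    have hc : ∀ᶠ n : ℕ in (U : Filter ℕ), dist (f n z) (F z) < e / 3 :=
      (Metric.tendsto_nhds.1 (hF z hz)) (e / 3) (by positivity)
    filter_upwards [hlip, hc] with n h1 h2 y hy
    have hy1 : y ∈ ball z ρ := ball_subset_ball (min_le_left _ _) hy
    have hy2 : dist y z < ρ * (e / 3) := ball_subset_ball (min_le_right _ _) hy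
    have hy3 : ρ⁻¹ * dist y z < e / 3 := by
      rw [inv_mul_lt_iff₀ hρ]; exact hy2
    have h3 := hlipF y hy1
    have h4 := h1 y hy1
    have h5 := dist_triangle4 (F y) (F z) (f n z) (f n y)
    rw [dist_comm (F z), dist_comm (f n z) (f n y)] at h5
    linarith
  have hFd : DifferentiableOn ℂ F Kᶜ := by
    intro z hz
    obtain ⟨ρ, hρ, hev⟩ := hsep z hz
    have hballK : ball z ρ ⊆ Kᶜ := by
      obtain ⟨n, hn⟩ := hev.exists
      exact ((ball_subset_ball (by linarith)).trans hn).trans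
        (compl_subset_compl.2 (self_subset_cthickening _))
    have h1 := (hlu.mono hballK).differentiableOn (hev.mono fun n hn =>
      (hadm n).1.mono ((ball_subset_ball (by linarith)).trans hn)) isOpen_ball
    exact (h1.differentiableAt (ball_mem_nhds z hρ)).differentiableWithinAt
  have hFb : ∀ z ∈ Kᶜ, ‖F z‖ ≤ 1 := fun z hz => le_of_tendsto (hF z hz).norm (hptb z hz)
  have hKc : ∀ z : ℂ, R < ‖z‖ → z ∈ Kᶜ := fun z hz hzK => by
    have := hKR₀ hzK
    rw [mem_closedBall_zero_iff] at this
    linarith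
  have hinf : HasDerivAtInftyOn F Kᶜ l' w' := by
    refine hasDerivAtInftyOn_of_bound (R := R) (C := 4 * R ^ 2) _ fun z hz => ?_
    have h1 : Tendsto (fun n => ‖z * (f n z - l n) - w n‖) U (𝓝 ‖z * (F z - l') - w'‖) :=
      ((((hF z (hKc z hz)).sub hl').const_mul z).sub hw').norm
    exact le_of_tendsto h1 (Eventually.of_forall fun n => (hexp n).2.2 z hz)
  have h1 : ‖w'‖ ≤ analyticCapacity K :=
    Adm.le_cap hK.isBounded (f := F) (l := l') ⟨hFd, hFb, hinf⟩
  have h2 : analyticCapacity K + η ≤ ‖w'‖ :=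
    ge_of_tendsto hw'.norm (Eventually.of_forall fun n => (hw n).le)
  linarith

/-! ### The Cauchy–Pompeiu formula -/

/-- Twice the Cauchy–Riemann operator. -/
def dbar (F : ℂ → ℂ) (z : ℂ) : ℂ := fderiv ℝ F z 1 + I * fderiv ℝ F z I

theorem lintegral_inv_ball (ρ : ℝ) :
    ∫⁻ t in ball (0 : ℂ) ρ, ‖t⁻¹‖ₑ = ENNReal.ofReal (2 * Real.pi * ρ) := by
  rw [← lintegral_indicator measurableSet_ball, ← Complex.lintegral_comp_polarCoord_symm]
  have h1 : ∀ p ∈ polarCoord.target, ENNReal.ofReal p.1 •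
      (ball (0 : ℂ) ρ).indicator (fun t => ‖t⁻¹‖ₑ) (Complex.polarCoord.symm p) =
      (Iio ρ ×ˢ univ).indicator (fun _ => 1) p := by
    rintro ⟨r, θ⟩ ⟨hr, hθ⟩
    have hr' : 0 < r := hr
    have hn : ‖Complex.polarCoord.symm (r, θ)‖ = r := by
      rw [Complex.norm_polarCoord_symm]; exact abs_of_pos hr'
    by_cases h : r < ρ
    · rw [indicator_of_mem, indicator_of_mem]
      · rw [← ofReal_norm, norm_inv, hn, smul_eq_mul, ← ENNReal.ofReal_mul hr'.le,
          mul_inv_cancel₀ hr'.ne', ENNReal.ofReal_one]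
      · exact ⟨h, mem_univ _⟩
      · rw [mem_ball_zero_iff, hn]; exact h
    · rw [indicator_of_notMem, indicator_of_notMem, smul_zero]
      · rintro ⟨h', -⟩; exact h h'
      · rw [mem_ball_zero_iff, hn]; exact h
  rw [setLIntegral_congr_fun polarCoord.open_target.measurableSet h1,
    lintegral_indicator (measurableSet_Iio.prod MeasurableSet.univ), setLIntegral_one,
    Measure.restrict_apply (measurableSet_Iio.prod MeasurableSet.univ), polarCoord_target,
    prod_inter_prod, univ_inter, Measure.volume_eq_prod, Measure.prod_prod, Iio_inter_Ioi,
    Real.volume_Ioo, Real.volume_Ioo, mul_comm, ← ENNReal.ofReal_mul (by linarith [Real.pi_pos])]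
  congr 1
  ring

theorem integrableOn_inv_ball (ρ : ℝ) : IntegrableOn (fun t : ℂ => t⁻¹) (ball 0 ρ) := by
  refine ⟨measurable_inv.aestronglyMeasurable, ?_⟩
  rw [HasFiniteIntegral, lintegral_inv_ball]
  exact ENNReal.ofReal_lt_top

theorem integral_norm_inv_ball {ρ : ℝ} (hρ : 0 ≤ ρ) :
    ∫ t in ball (0 : ℂ) ρ, ‖t⁻¹‖ = 2 * Real.pi * ρ := by
  rw [integral_norm_eq_lintegral_enorm measurable_inv.aestronglyMeasurable, lintegral_inv_ball,
    ENNReal.toReal_ofReal (by have := Real.pi_pos; positivity)]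

theorem locallyIntegrable_inv : LocallyIntegrable (fun t : ℂ => t⁻¹) := by
  intro x
  refine ⟨ball 0 (‖x‖ + 1), isOpen_ball.mem_nhds (by simp), integrableOn_inv_ball _⟩

theorem pompeiu {h : ℂ → ℂ} (hc : ContDiff ℝ 1 h) (hs : HasCompactSupport h) (z : ℂ) :
    ∫ t, t⁻¹ * dbar h (z - t) = 2 * Real.pi * h z := by
  have hD : Continuous (fderiv ℝ h) := hc.continuous_fderiv one_ne_zero
  have hdiff : Differentiable ℝ h := hc.differentiable one_ne_zero
  obtain ⟨R₁, hR₁, hsR⟩ := hs.isCompact.isBounded.subset_closedBall_lt 0 0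
  set R := R₁ + ‖z‖ with hR
  have hR0 : 0 < R := by positivity
  set e : ℝ → ℂ := fun θ => cexp (θ * I) with he
  have hec : Continuous e := by fun_prop
  have hen : ∀ θ, ‖e θ‖ = 1 := fun θ => norm_exp_ofReal_mul_I θ
  set A : ℝ × ℝ → ℂ := fun p => fderiv ℝ h (z - p.1 * e p.2) (e p.2) with hA
  set B : ℝ × ℝ → ℂ := fun p => fderiv ℝ h (z - p.1 * e p.2) (I * e p.2) with hB
  have hAc : Continuous A := by
    refine Continuous.clm_apply (hD.comp ?_) ?_ <;> fun_prop
  have hBc : Continuous B := by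
    refine Continuous.clm_apply (hD.comp ?_) ?_ <;> fun_prop
  have hout : ∀ r θ : ℝ, R < r → z - r * e θ ∉ tsupport h := by
    intro r θ hr hmem
    have h1 := hsR hmem
    rw [mem_closedBall_zero_iff] at h1
    have h2 : ‖(r : ℂ) * e θ‖ = r := by
      rw [norm_mul, hen, mul_one, norm_real, Real.norm_of_nonneg (hR0.trans hr).le]
    have h3 := norm_sub_norm_le ((r : ℂ) * e θ) z
    rw [norm_sub_rev] at h3
    linarith
  have hfd0 : ∀ r θ : ℝ, R < r → fderiv ℝ h (z - r * e θ) = 0 := fun r θ hr =>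
    image_eq_zero_of_notMem_tsupport fun hm => hout r θ hr (tsupport_fderiv_subset ℝ hm)
  set T : Set (ℝ × ℝ) := Ioi (0 : ℝ) ×ˢ Ioo (-Real.pi) Real.pi with hT
  have hint : ∀ G : ℝ × ℝ → ℂ, Continuous G → (∀ r θ, R < r → G (r, θ) = 0) →
      IntegrableOn G T := by
    intro G hG h0
    have h1 : IntegrableOn G (Icc 0 R ×ˢ Icc (-Real.pi) Real.pi) :=
      hG.continuousOn.integrableOn_compact (isCompact_Icc.prod isCompact_Icc)
    refine IntegrableOn.of_forall_sdiff_eq_zero h1 (measurableSet_Ioi.prod measurableSet_Ioo) ?_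
    rintro ⟨r, θ⟩ ⟨⟨h2, h3⟩, h4⟩
    refine h0 r θ ?_
    by_contra hr
    exact h4 ⟨⟨(le_of_lt h2 : (0 : ℝ) ≤ r), not_lt.1 hr⟩, Ioo_subset_Icc_self h3⟩
  have hAi : IntegrableOn A T := hint A hAc fun r θ hr => by simp [hA, hfd0 r θ hr]
  have hBi : IntegrableOn B T := hint B hBc fun r θ hr => by simp [hB, hfd0 r θ hr]
  have hpol : ∫ t, t⁻¹ * dbar h (z - t) = ∫ p in T, (A p + I * B p) := by
    rw [← Complex.integral_comp_polarCoord_symm]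
    refine setIntegral_congr_fun (measurableSet_Ioi.prod measurableSet_Ioo) ?_
    rintro ⟨r, θ⟩ ⟨hr, hθ⟩
    have hr' : (0 : ℝ) < r := hr
    have hrc : (r : ℂ) ≠ 0 := by exact_mod_cast hr'.ne'
    have e1 : Complex.polarCoord.symm (r, θ) = r * e θ := by
      rw [Complex.polarCoord_symm_apply, he]
      simp only [exp_mul_I, ofReal_cos, ofReal_sin]
    have e0 : e θ ≠ 0 := exp_ne_zero _
    simp only [e1, hA, hB, dbar, real_smul]
    set L := fderiv ℝ h (z - r * e θ) with hL
    have hlin : ∀ v : ℂ, L v = v.re * L 1 + v.im * L I := by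
      intro v
      conv_lhs => rw [← re_add_im v]
      rw [map_add]
      have t1 : (v.re : ℂ) = v.re • (1 : ℂ) := by simp
      have t2 : (v.im : ℂ) * I = v.im • I := by simp
      rw [t2, map_smul, t1, map_smul]
      simp
    have hinv : (e θ)⁻¹ = (e θ).re - (e θ).im * I := by
      rw [inv_def, normSq_eq_norm_sq, hen]
      simp [Complex.ext_iff]
    rw [hlin (e θ), hlin (I * e θ), mul_inv, hinv]
    field_simp
    simp only [mul_re, mul_im, I_re, I_im]
    push_cast
    ring_nf
    simp only [I_sq]
    ring
  have hBint : ∫ p in T, B p = 0 := by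
    rw [hT, Measure.volume_eq_prod, setIntegral_prod _ hBi]
    refine setIntegral_eq_zero_of_forall_eq_zero fun r hr => ?_
    have hr' : (0 : ℝ) < r := hr
    have hrc : (r : ℂ) ≠ 0 := by exact_mod_cast hr'.ne'
    rw [← integral_Ioc_eq_integral_Ioo, ← intervalIntegral.integral_of_le (by linarith [Real.pi_pos])]
    have hder : ∀ θ : ℝ, HasDerivAt (fun θ : ℝ => h (z - r * e θ)) (-(r : ℂ) * B (r, θ)) θ := by
      intro θ
      have h1 : HasDerivAt (fun θ : ℝ => z - r * e θ) (-(r * (I * e θ))) θ := by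
        have h0 : HasDerivAt (fun θ : ℝ => (θ : ℂ) * I) (1 * I) θ :=
          (hasDerivAt_id θ).ofReal_comp.mul_const I
        have := ((h0.cexp).const_mul (r : ℂ)).const_sub z
        refine this.congr_deriv ?_
        simp only [he]; ring
      have h2 := (hdiff (z - r * e θ)).hasFDerivAt.comp_hasDerivAt θ h1
      refine h2.congr_deriv ?_
      rw [map_neg]
      have : (r : ℂ) * (I * e θ) = r • (I * e θ) := by simp
      rw [this, map_smul, real_smul]
      simp [hB]
    have hI := intervalIntegral.integral_eq_sub_of_hasDerivAt (a := -Real.pi) (b := Real.pi)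
      (fun θ _ => hder θ) (by
        refine Continuous.intervalIntegrable ?_ _ _
        exact continuous_const.mul (hBc.comp (by fun_prop)))
    have hpi : e Real.pi = e (-Real.pi) := by
      simp only [he]
      rw [ofReal_neg, neg_mul, exp_neg, exp_pi_mul_I]; norm_num
    rw [hpi, sub_self, intervalIntegral.integral_const_mul] at hI
    exact (mul_eq_zero.1 hI).resolve_left (neg_ne_zero.2 hrc)
  have hAint : ∫ p in T, A p = 2 * Real.pi * h z := by
    rw [hT, Measure.volume_eq_prod, ← setIntegral_prod_swap, setIntegral_prod]
    · have hin : ∀ θ : ℝ, ∫ r in Ioi (0 : ℝ), A (r, θ) = h z := by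
        intro θ
        have hder : ∀ r : ℝ, HasDerivAt (fun r : ℝ => -h (z - r * e θ)) (A (r, θ)) r := by
          intro r
          have h1 : HasDerivAt (fun r : ℝ => z - r * e θ) (-(1 * e θ)) r :=
            ((hasDerivAt_id r).ofReal_comp.mul_const (e θ)).const_sub z
          have h2 := ((hdiff (z - r * e θ)).hasFDerivAt.comp_hasDerivAt r h1).neg
          refine h2.congr_deriv ?_
          simp [hA]
        have hz : ∀ r, R < r → h (z - r * e θ) = 0 := fun r hr =>
          image_eq_zero_of_notMem_tsupport (hout r θ hr)
        have hi : IntegrableOn (fun r => A (r, θ)) (Ioi 0) := by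
          have h1 : IntegrableOn (fun r => A (r, θ)) (Icc 0 R) :=
            (hAc.comp (by fun_prop : Continuous fun r : ℝ => (r, θ))).continuousOn.integrableOn_compact
              isCompact_Icc
          refine IntegrableOn.of_forall_sdiff_eq_zero h1 measurableSet_Ioi ?_
          rintro r ⟨h2, h4⟩
          have hr : R < r := by
            by_contra hr
            exact h4 ⟨(le_of_lt h2 : (0 : ℝ) ≤ r), not_lt.1 hr⟩
          simp [hA, hfd0 r θ hr]
        rw [integral_Ioi_of_hasDerivAt_of_tendsto' (m := 0) (fun r _ => hder r) hi]
        · simp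
        · refine tendsto_const_nhds.congr' ?_
          filter_upwards [eventually_gt_atTop R] with r hr
          rw [hz r hr, neg_zero]
      simp only [Prod.swap_prod_mk, hin]
      rw [setIntegral_const, measureReal_def, Real.volume_Ioo,
        ENNReal.toReal_ofReal (by linarith [Real.pi_pos])]
      rw [real_smul]; push_cast; ring
    · rw [hT, Measure.volume_eq_prod, IntegrableOn, ← Measure.prod_restrict] at hAi
      rw [IntegrableOn, ← Measure.prod_restrict]
      exact hAi.swap
  rw [hpol, integral_add hAi (hBi.const_mul I), integral_const_mul, hBint, hAint]
  ring

theorem cauchy_transform_infty {φ : ℂ → ℂ} (hφ : Continuous φ) (hs : HasCompactSupport φ) :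
    HasDerivAtInftyOn (fun z => ∫ ζ, φ ζ * (z - ζ)⁻¹) univ 0 (∫ ζ, φ ζ) := by
  obtain ⟨R, hR, hsR⟩ := hs.isCompact.isBounded.subset_closedBall_lt 0 0
  have hφi : Integrable φ := hφ.integrable_of_hasCompactSupport hs
  refine hasDerivAtInftyOn_of_bound (R := 2 * R) (C := (∫ ζ, ‖φ ζ‖) * (2 * R)) _ fun z hz => ?_
  have hfar : ∀ ζ, φ ζ ≠ 0 → ‖ζ‖ ≤ R ∧ ‖z‖ / 2 ≤ ‖z - ζ‖ := by
    intro ζ hζ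
    have h1 : ‖ζ‖ ≤ R := by simpa using hsR (subset_tsupport _ hζ)
    exact ⟨h1, by linarith [norm_sub_norm_le z ζ]⟩
  have hz0 : 0 < ‖z‖ := by linarith
  have hint : Integrable (fun ζ => φ ζ * (z - ζ)⁻¹) := by
    refine (hφi.norm.const_mul (2 / ‖z‖)).mono' ?_ (Eventually.of_forall fun ζ => ?_)
    · exact hφ.aestronglyMeasurable.mul
        (measurable_inv.comp (measurable_const.sub measurable_id)).aestronglyMeasurable
    · by_cases h : φ ζ = 0
      · simp [h]
      · rw [norm_mul, norm_inv, mul_comm]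
        gcongr
        rw [inv_le_comm₀ (by linarith [(hfar ζ h).2]) (by positivity), inv_div]
        exact (hfar ζ h).2
  rw [sub_zero, ← integral_const_mul, ← integral_sub (hint.const_mul z) hφi, mul_div_assoc,
    ← integral_mul_const]
  refine norm_integral_le_of_norm_le (hφi.norm.mul_const _) (Eventually.of_forall fun ζ => ?_)
  by_cases h : φ ζ = 0
  · simp [h]
  · obtain ⟨h1, h2⟩ := hfar ζ h
    have hne : z - ζ ≠ 0 := norm_pos_iff.1 (by linarith)
    have e1 : z * (φ ζ * (z - ζ)⁻¹) - φ ζ = φ ζ * (ζ / (z - ζ)) := by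
      field_simp; ring
    rw [e1, norm_mul, norm_div]
    gcongr ‖φ ζ‖ * ?_
    rw [div_le_div_iff₀ (by linarith) hz0]
    nlinarith

theorem cauchy_rep {F : ℂ → ℂ} {l w : ℂ} (hF : ContDiff ℝ 2 F)
    (hs : HasCompactSupport (dbar F)) (hinf : HasDerivAtInftyOn F univ l w) :
    (∀ z, F z = l + (2 * Real.pi : ℂ)⁻¹ * ∫ ζ, dbar F ζ * (z - ζ)⁻¹) ∧
      w = (2 * Real.pi : ℂ)⁻¹ * ∫ ζ, dbar F ζ := by
  have hpi : (2 * Real.pi : ℂ) ≠ 0 := by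
    have := Real.pi_pos.ne'
    simp [this]
  have hfd : ContDiff ℝ 1 (fderiv ℝ F) := hF.fderiv_right (m := 1) (by norm_num)
  have hφ : ContDiff ℝ 1 (dbar F) := by
    unfold dbar
    exact (hfd.clm_apply contDiff_const).add (contDiff_const.mul (hfd.clm_apply contDiff_const))
  set φ := dbar F with hφdef
  have hφD : Continuous (fderiv ℝ φ) := hφ.continuous_fderiv one_ne_zero
  set u : ℂ → ℂ := fun z => ∫ ζ, φ ζ * (z - ζ)⁻¹ with hu
  set k : ℂ → ℂ := fun t => t⁻¹ with hk
  have hki : LocallyIntegrable k := locallyIntegrable_inv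
  set L := ContinuousLinearMap.mul ℝ ℂ with hL
  have huconv : u = MeasureTheory.convolution k φ L volume := by
    ext z
    rw [MeasureTheory.convolution_def, hu, ← integral_sub_left_eq_self _ _ z]
    simp [hL, hk, mul_comm]
  have hder : ∀ z, HasFDerivAt u (MeasureTheory.convolution k (fderiv ℝ φ) (L.precompR ℂ) volume z) z := by
    intro z
    rw [huconv]
    exact hs.hasFDerivAt_convolution_right L hki hφ z
  have hsD : HasCompactSupport (fderiv ℝ φ) := hs.fderiv ℝ
  have happ : ∀ z v, fderiv ℝ u z v = ∫ t, k t * fderiv ℝ φ (z - t) v := by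
    intro z v
    rw [(hder z).fderiv, MeasureTheory.convolution_precompR_apply L hki hsD hφD,
      MeasureTheory.convolution_def]
    simp [hL]
  have hint : ∀ z v, Integrable (fun t => k t * fderiv ℝ φ (z - t) v) := by
    intro z v
    have hcs : HasCompactSupport (fun a => fderiv ℝ φ a v) :=
      hsD.comp_left (g := fun T : ℂ →L[ℝ] ℂ => T v) (by simp)
    have := hcs.convolutionExists_right L hki (hφD.clm_apply continuous_const) z
    simpa [MeasureTheory.ConvolutionExistsAt, hL] using this
  have hdu : ∀ z, dbar u z = 2 * Real.pi * φ z := by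
    intro z
    rw [← pompeiu hφ hs z, dbar, happ, happ, ← integral_const_mul,
      ← integral_add (hint z 1) ((hint z I).const_mul I)]
    congr 1
    ext t
    simp only [dbar, hk]
    ring
  set G : ℂ → ℂ := fun z => F z - (2 * Real.pi : ℂ)⁻¹ * u z with hG
  have hFdiff : Differentiable ℝ F := hF.differentiable two_ne_zero
  have hGd : Differentiable ℂ G := by
    intro z
    have hc := (hder z).differentiableAt.hasFDerivAt.const_mul (2 * Real.pi : ℂ)⁻¹
    have h1 := (hFdiff z).hasFDerivAt.fun_sub hc
    refine differentiableAt_complex_iff_differentiableAt_real.2 ⟨h1.differentiableAt, ?_⟩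
    have h3 : fderiv ℝ G z = _ := h1.fderiv
    rw [h3]
    have h2 := hdu z
    simp only [hφdef, dbar] at h2
    simp only [_root_.sub_apply, _root_.smul_apply, smul_eq_mul]
    have h4 : fderiv ℝ F z 1 + I * fderiv ℝ F z I =
        (2 * Real.pi : ℂ)⁻¹ * (fderiv ℝ u z 1 + I * fderiv ℝ u z I) := by
      rw [h2]; field_simp
    linear_combination (-I) * h4 + (fderiv ℝ F z I - (2 * Real.pi : ℂ)⁻¹ * fderiv ℝ u z I) * I_sq
  have huinf := cauchy_transform_infty hφ.continuous hs
  change HasDerivAtInftyOn u univ 0 (∫ ζ, φ ζ) at huinf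
  unfold HasDerivAtInftyOn at huinf hinf
  simp only [principal_univ, inf_top_eq] at huinf hinf
  have hGl : Tendsto G (cobounded ℂ) (𝓝 (l - (2 * Real.pi : ℂ)⁻¹ * 0)) :=
    hinf.1.sub (huinf.1.const_mul _)
  rw [mul_zero, sub_zero, cobounded_eq_cocompact] at hGl
  have hGc : ∀ z, G z = l := fun z => hGd.apply_eq_of_tendsto_cocompact z hGl
  have hFu : ∀ z, F z = l + (2 * Real.pi : ℂ)⁻¹ * u z := fun z => by
    rw [← hGc z, hG]; ring
  refine ⟨hFu, ?_⟩
  have h5 : Tendsto (fun z => z * (F z - l)) (cobounded ℂ)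
      (𝓝 ((2 * Real.pi : ℂ)⁻¹ * ∫ ζ, φ ζ)) := by
    refine (huinf.2.const_mul (2 * Real.pi : ℂ)⁻¹).congr fun z => ?_
    rw [hFu z]; ring
  exact tendsto_nhds_unique hinf.2 h5

/-! ### Smoothing of an admissible function -/

theorem dbar_eq_zero {F : ℂ → ℂ} {z : ℂ} (h : DifferentiableAt ℂ F z) : dbar F z = 0 := by
  rw [dbar, (differentiableAt_complex_iff_differentiableAt_real.1 h).2, smul_eq_mul, ← mul_assoc,
    I_mul_I]
  ring

theorem exists_smooth {K : Set ℂ} (hK : IsCompact K) {ε : ℝ} (hε : 0 < ε) {f : ℂ → ℂ} {l w : ℂ}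
    (h : Adm K f l w) : ∃ F : ℂ → ℂ, ContDiff ℝ 2 F ∧ (∀ z, ‖F z‖ ≤ 1) ∧
      HasDerivAtInftyOn F univ l w ∧ HasCompactSupport (dbar F) ∧
      ∀ z, dbar F z ≠ 0 → z ∈ cthickening ε K := by
  have hKint : K ⊆ interior (cthickening ε K) := by
    refine (self_subset_thickening hε K).trans ?_
    exact interior_maximal (thickening_subset_cthickening _ _) isOpen_thickening
  obtain ⟨ψ, h1, h2, h3⟩ := exists_contMDiffMap_one_nhds_of_subset_interior (modelWithCornersSelf ℝ ℂ)
    (n := 2) hK.isClosed hKint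
  have hψ : ContDiff ℝ 2 ψ := ψ.contMDiff.contDiff
  have hKo : IsOpen Kᶜ := hK.isClosed.isOpen_compl
  set F : ℂ → ℂ := fun z => f z * ((1 - ψ z : ℝ) : ℂ) with hF
  have hnear : ∀ z ∈ K, F =ᶠ[𝓝 z] fun _ => 0 := by
    intro z hz
    have : ∀ᶠ x in 𝓝 z, ψ x = 1 := h1.filter_mono (nhds_le_nhdsSet hz)
    filter_upwards [this] with x hx
    simp [hF, hx]
  have hfar : ∀ z, z ∉ cthickening ε K → F =ᶠ[𝓝 z] f := by
    intro z hz
    filter_upwards [isClosed_cthickening.isOpen_compl.mem_nhds hz] with x hx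
    simp [hF, h2 x hx]
  have hdb : ∀ z, dbar F z ≠ 0 → z ∈ cthickening ε K := by
    intro z hz
    by_contra hzK
    refine hz (dbar_eq_zero ?_)
    have hzK' : z ∈ Kᶜ := fun h => hzK (self_subset_cthickening K h)
    exact (h.1.differentiableAt (hKo.mem_nhds hzK')).congr_of_eventuallyEq (hfar z hzK)
  refine ⟨F, ?_, ?_, ?_, ?_, hdb⟩
  · rw [contDiff_iff_contDiffAt]
    intro z
    by_cases hz : z ∈ K
    · exact contDiffAt_const.congr_of_eventuallyEq (hnear z hz)
    · have ha : ContDiffAt ℂ 2 f z := (h.1.analyticAt (hKo.mem_nhds hz)).contDiffAt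
      have hb : ContDiff ℝ 2 (fun z => ((1 - ψ z : ℝ) : ℂ)) :=
        ofRealCLM.contDiff.comp (contDiff_const.sub hψ)
      exact (ha.restrict_scalars ℝ).mul hb.contDiffAt
  · intro z
    by_cases hz : z ∈ K
    · rw [(hnear z hz).eq_of_nhds]; simp
    · have hf1 := h.2.1 z hz
      have h4 := h3 z
      rw [hF]
      simp only [norm_mul, norm_real]
      rw [Real.norm_of_nonneg (by linarith [h4.2])]
      nlinarith [h4.1, h4.2, norm_nonneg (f z)]
  · have hb : Kᶜ ∈ cobounded ℂ := isBounded_def.1 hK.isBounded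
    have hb2 : (cthickening ε K)ᶜ ∈ cobounded ℂ := isBounded_def.1 hK.isBounded.cthickening
    have hi := h.2.2
    unfold HasDerivAtInftyOn at hi ⊢
    rw [inf_eq_left.2 (le_principal_iff.2 hb)] at hi
    rw [principal_univ, inf_top_eq]
    refine ⟨hi.1.congr' ?_, hi.2.congr' ?_⟩ <;>
    · filter_upwards [hb2] with z hz
      rw [(hfar z hz).eq_of_nhds]
  · exact HasCompactSupport.intro hK.cthickening fun z hz => by
      by_contra hne
      exact hz (hdb z hne)

/-! ### Discretization -/

/-- Index of the grid square of side `δ` containing `ζ`. -/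
def idx (δ : ℝ) (ζ : ℂ) : ℤ × ℤ := (⌊ζ.re / δ⌋, ⌊ζ.im / δ⌋)

/-- Center of the grid square. -/
def ctr (δ : ℝ) (j : ℤ × ℤ) : ℂ := ⟨δ * (j.1 + 1 / 2), δ * (j.2 + 1 / 2)⟩

theorem norm_sub_ctr_le {δ : ℝ} (hδ : 0 < δ) (ζ : ℂ) : ‖ζ - ctr δ (idx δ ζ)‖ ≤ δ := by
  have key : ∀ x : ℝ, |x - δ * ((⌊x / δ⌋ : ℝ) + 1 / 2)| ≤ δ / 2 := by
    intro x
    have h1 := Int.floor_le (x / δ)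
    have h2 := Int.lt_floor_add_one (x / δ)
    rw [le_div_iff₀ hδ] at h1
    rw [div_lt_iff₀ hδ] at h2
    rw [abs_le]
    constructor <;> nlinarith
  refine (norm_le_abs_re_add_abs_im _).trans ?_
  have h1 := key ζ.re
  have h2 := key ζ.im
  simp only [sub_re, sub_im, ctr, idx]
  linarith

theorem le_dist_ctr {δ : ℝ} (hδ : 0 < δ) {i j : ℤ × ℤ} (hij : i ≠ j) :
    δ ≤ dist (ctr δ i) (ctr δ j) := by
  have key : ∀ m n : ℤ, m ≠ n → δ ≤ |δ * ((m : ℝ) + 1 / 2) - δ * ((n : ℝ) + 1 / 2)| := by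
    intro m n hmn
    have h1 : (1 : ℝ) ≤ |(m : ℝ) - n| := by
      have : 1 ≤ |m - n| := Int.one_le_abs (sub_ne_zero.2 hmn)
      exact_mod_cast this
    have h2 : δ * ((m : ℝ) + 1 / 2) - δ * ((n : ℝ) + 1 / 2) = δ * (m - n) := by ring
    rw [h2, abs_mul, abs_of_pos hδ]
    nlinarith
  rw [dist_eq_norm]
  by_cases h : i.1 = j.1
  · have h' : i.2 ≠ j.2 := fun h2 => hij (Prod.ext h h2)
    exact (key _ _ h').trans (by simpa [ctr] using abs_im_le_norm (ctr δ i - ctr δ j))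
  · exact (key _ _ h).trans (by simpa [ctr] using abs_re_le_norm (ctr δ i - ctr δ j))

theorem measurable_idx (δ : ℝ) : Measurable (idx δ) :=
  ((measurable_re.div_const δ).floor).prodMk ((measurable_im.div_const δ).floor)

theorem finite_idx {δ : ℝ} (hδ : 0 < δ) {S : Set ℂ} (hS : IsBounded S) : (idx δ '' S).Finite := by
  obtain ⟨R, hR, hSR⟩ := hS.subset_closedBall_lt 0 0
  refine ((finite_Icc ⌊-R / δ⌋ ⌊R / δ⌋).prod (finite_Icc ⌊-R / δ⌋ ⌊R / δ⌋)).subset ?_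
  rintro _ ⟨ζ, hζ, rfl⟩
  have h1 : ‖ζ‖ ≤ R := by simpa using hSR hζ
  have h2 := abs_le.1 ((abs_re_le_norm ζ).trans h1)
  have h3 := abs_le.1 ((abs_im_le_norm ζ).trans h1)
  refine ⟨⟨?_, ?_⟩, ⟨?_, ?_⟩⟩ <;> refine Int.floor_le_floor ?_
  exacts [div_le_div_of_nonneg_right h2.1 hδ.le, div_le_div_of_nonneg_right h2.2 hδ.le,
    div_le_div_of_nonneg_right h3.1 hδ.le, div_le_div_of_nonneg_right h3.2 hδ.le]

theorem sum_squares {δ : ℝ} {φ : ℂ → ℂ} (hφ : Integrable φ) (J : Finset (ℤ × ℤ))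
    (hJ : ∀ ζ, φ ζ ≠ 0 → idx δ ζ ∈ J) (b : ℤ × ℤ → ℂ) :
    ∑ j ∈ J, (∫ ζ in idx δ ⁻¹' {j}, φ ζ) * b j = ∫ ζ, φ ζ * b (idx δ ζ) := by
  have hm : ∀ j, MeasurableSet (idx δ ⁻¹' {j}) := fun j =>
    measurable_idx δ (measurableSet_singleton j)
  have hc : ∀ j, EqOn (fun ζ => φ ζ * b j) (fun ζ => φ ζ * b (idx δ ζ)) (idx δ ⁻¹' {j}) := by
    intro j ζ hζ
    have : idx δ ζ = j := hζ
    simp [this]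
  rw [← setIntegral_eq_integral_of_forall_compl_eq_zero (s := ⋃ j ∈ J, idx δ ⁻¹' {j}),
    integral_biUnion_finset]
  · refine Finset.sum_congr rfl fun j _ => ?_
    rw [← integral_mul_const]
    exact setIntegral_congr_fun (hm j) (hc j)
  · exact fun j _ => hm j
  · intro i _ j _ hij
    refine Disjoint.preimage _ ?_
    simpa using hij
  · intro j _
    exact ((hφ.mul_const (b j)).integrableOn).congr_fun (hc j) (hm j)
  · intro ζ hζ
    by_contra hne
    refine hζ ?_
    simp only [mem_iUnion]
    exact ⟨idx δ ζ, hJ ζ (left_ne_zero_of_mul hne), rfl⟩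

theorem discretize {φ : ℂ → ℂ} (hφ : Continuous φ) {S : Set ℂ} (hS : IsCompact S)
    (hφS : ∀ ζ, φ ζ ≠ 0 → ζ ∈ S) {η : ℝ} (hη : 0 < η) :
    ∃ δ₀ > 0, ∀ δ, 0 < δ → δ ≤ δ₀ → ∀ J : Finset (ℤ × ℤ), idx δ '' S ⊆ J →
      ∀ z, (∀ j ∈ J, δ / 4 ≤ ‖z - ctr δ j‖) →
      ‖(∫ ζ, φ ζ * (z - ζ)⁻¹) - ∑ j ∈ J, (∫ ζ in idx δ ⁻¹' {j}, φ ζ) * (z - ctr δ j)⁻¹‖ ≤ η := by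
  have hcs : HasCompactSupport φ := HasCompactSupport.intro hS fun z hz => by
    by_contra hne; exact hz (hφS z hne)
  have hφi : Integrable φ := hφ.integrable_of_hasCompactSupport hcs
  obtain ⟨M₀, hM₀⟩ := hcs.exists_bound_of_continuous hφ
  obtain ⟨M, hMpos, hM⟩ : ∃ M > 0, ∀ x, ‖φ x‖ ≤ M :=
    ⟨max M₀ 1, by positivity, fun x => (hM₀ x).trans (le_max_left _ _)⟩
  have hpi := Real.pi_pos
  set V := volume.real S with hV
  have hV0 : 0 ≤ V := measureReal_nonneg
  set ρ := η / (16 * Real.pi * M) with hρ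
  have hρ0 : 0 < ρ := by positivity
  refine ⟨η * ρ ^ 2 / (10 * M * (V + 1)), by positivity, ?_⟩
  intro δ hδ hδ₀ J hJ z hz
  have hJ' : ∀ ζ, φ ζ ≠ 0 → idx δ ζ ∈ J := fun ζ h => hJ ⟨ζ, hφS ζ h, rfl⟩
  rw [sum_squares hφi J hJ' (fun j => (z - ctr δ j)⁻¹)]
  set B : ℂ → ℝ := fun ζ => M * (4 * (ball z ρ).indicator (fun ζ => ‖(z - ζ)⁻¹‖) ζ) +
    M * (5 * δ / ρ ^ 2 * S.indicator (fun _ => 1) ζ) with hB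
  have hkey : ∀ ζ, ζ ≠ z →
      ‖φ ζ * (z - ζ)⁻¹ - φ ζ * (z - ctr δ (idx δ ζ))⁻¹‖ ≤ B ζ := by
    intro ζ hζ
    have hI1 : 0 ≤ (ball z ρ).indicator (fun ζ => ‖(z - ζ)⁻¹‖) ζ :=
      indicator_nonneg (fun _ _ => norm_nonneg _) _
    have hI2 : (0 : ℝ) ≤ S.indicator (fun _ => 1) ζ := indicator_nonneg (fun _ _ => zero_le_one) _
    by_cases h0 : φ ζ = 0
    · simp only [h0, zero_mul, sub_zero, norm_zero, hB]
      positivity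
    set c := ctr δ (idx δ ζ) with hc
    have hp : δ / 4 ≤ ‖z - c‖ := hz _ (hJ' ζ h0)
    have hq : ‖ζ - c‖ ≤ δ := norm_sub_ctr_le hδ ζ
    have hp0 : 0 < ‖z - c‖ := by linarith
    have hne : z - ζ ≠ 0 := sub_ne_zero.2 hζ.symm
    have hd0 : 0 < ‖z - ζ‖ := norm_pos_iff.2 hne
    have hd : ‖z - ζ‖ ≤ 5 * ‖z - c‖ := by
      have : ‖z - ζ‖ ≤ ‖z - c‖ + ‖ζ - c‖ := by
        have e : z - ζ = (z - c) - (ζ - c) := by ring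
        rw [e]; exact norm_sub_le _ _
      linarith
    have hce : z - c ≠ 0 := norm_pos_iff.1 hp0
    have e1 : φ ζ * (z - ζ)⁻¹ - φ ζ * (z - c)⁻¹ = φ ζ * ((ζ - c) / ((z - ζ) * (z - c))) := by
      field_simp; ring
    rw [e1, norm_mul, norm_div, norm_mul]
    have hM' := hM ζ
    have hquot : ‖ζ - c‖ / (‖z - ζ‖ * ‖z - c‖) ≤
        4 * (ball z ρ).indicator (fun ζ => ‖(z - ζ)⁻¹‖) ζ +
          5 * δ / ρ ^ 2 * S.indicator (fun _ => 1) ζ := by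
      by_cases hb : ζ ∈ ball z ρ
      · have t1 : ‖ζ - c‖ / (‖z - ζ‖ * ‖z - c‖) ≤ 4 * ‖(z - ζ)⁻¹‖ := by
          rw [norm_inv, div_le_iff₀ (by positivity)]
          have : 4 * ‖z - ζ‖⁻¹ * (‖z - ζ‖ * ‖z - c‖) = 4 * ‖z - c‖ := by
            field_simp
          rw [this]; linarith
        rw [indicator_of_mem hb]
        have : 0 ≤ 5 * δ / ρ ^ 2 * S.indicator (fun _ => (1 : ℝ)) ζ := by positivity
        linarith
      · have hρd : ρ ≤ ‖z - ζ‖ := by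
          rw [mem_ball, not_lt, dist_comm, dist_eq_norm] at hb; exact hb
        rw [indicator_of_notMem hb, indicator_of_mem (hφS ζ h0), mul_zero, zero_add, mul_one]
        rw [div_le_div_iff₀ (by positivity) (by positivity)]
        have t2 : ρ ^ 2 ≤ ‖z - ζ‖ * (5 * ‖z - c‖) := by
          rw [sq]; exact mul_le_mul hρd (hρd.trans hd) hρ0.le hd0.le
        calc ‖ζ - c‖ * ρ ^ 2 ≤ δ * (‖z - ζ‖ * (5 * ‖z - c‖)) := by gcongr
          _ = _ := by ring
    calc _ ≤ M * (4 * (ball z ρ).indicator (fun ζ => ‖(z - ζ)⁻¹‖) ζ +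
          5 * δ / ρ ^ 2 * S.indicator (fun _ => 1) ζ) := by gcongr
      _ = B ζ := by rw [hB]; ring
  have hball : ∀ g : ℂ → ℝ, (ball z ρ).indicator (fun ζ => g (z - ζ)) =
      fun ζ => (ball (0 : ℂ) ρ).indicator g (z - ζ) := by
    intro g
    ext ζ
    simp only [indicator, mem_ball, dist_comm ζ z, dist_eq_norm, sub_zero]
  have hb0 : Integrable ((ball (0 : ℂ) ρ).indicator (fun t => ‖t⁻¹‖)) :=
    (show IntegrableOn (fun t : ℂ => ‖t⁻¹‖) (ball 0 ρ) volume from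
      (integrableOn_inv_ball ρ).norm).integrable_indicator measurableSet_ball
  have hI1 : Integrable ((ball z ρ).indicator (fun ζ => ‖(z - ζ)⁻¹‖)) := by
    rw [hball (fun t => ‖t⁻¹‖)]
    exact hb0.comp_sub_left z
  have hI1v : ∫ ζ, (ball z ρ).indicator (fun ζ => ‖(z - ζ)⁻¹‖) ζ = 2 * Real.pi * ρ := by
    rw [hball (fun t => ‖t⁻¹‖), integral_sub_left_eq_self _ _ z,
      integral_indicator measurableSet_ball, integral_norm_inv_ball hρ0.le]
  have hI2 : Integrable (S.indicator (fun _ => (1 : ℝ))) :=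
    (integrableOn_const hS.measure_lt_top.ne).integrable_indicator hS.measurableSet
  have hI2v : ∫ ζ, S.indicator (fun _ => (1 : ℝ)) ζ = V := by
    rw [integral_indicator hS.measurableSet]; simp [hV]
  have hBi : Integrable B :=
    ((hI1.const_mul 4).const_mul M).add ((hI2.const_mul _).const_mul M)
  have hBv : ∫ ζ, B ζ = M * (4 * (2 * Real.pi * ρ)) + M * (5 * δ / ρ ^ 2 * V) := by
    rw [hB, integral_add ((hI1.const_mul 4).const_mul M) ((hI2.const_mul _).const_mul M)]
    simp only [integral_const_mul, hI1v, hI2v]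
  have hmeas : Measurable fun ζ => (z - ctr δ (idx δ ζ))⁻¹ :=
    (Measurable.of_discrete (f := fun j : ℤ × ℤ => (z - ctr δ j)⁻¹)).comp (measurable_idx δ)
  have hmeas2 : Measurable fun ζ : ℂ => (z - ζ)⁻¹ :=
    (measurable_const.sub measurable_id).inv
  have hi2 : Integrable fun ζ => φ ζ * (z - ctr δ (idx δ ζ))⁻¹ := by
    refine (hφi.norm.const_mul (4 / δ)).mono'
      (hφ.aestronglyMeasurable.mul hmeas.aestronglyMeasurable) (Eventually.of_forall fun ζ => ?_)
    by_cases h : φ ζ = 0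
    · simp [h]
    · rw [norm_mul, norm_inv, mul_comm]
      gcongr
      have := hz _ (hJ' ζ h)
      rw [inv_le_comm₀ (by linarith) (by positivity), inv_div]
      exact this
  have hae : ∀ᵐ ζ : ℂ, ‖φ ζ * (z - ζ)⁻¹ - φ ζ * (z - ctr δ (idx δ ζ))⁻¹‖ ≤ B ζ := by
    have : ∀ᵐ ζ : ℂ, ζ ≠ z := by
      rw [ae_iff]; simp
    exact this.mono hkey
  have hiD : Integrable fun ζ => φ ζ * (z - ζ)⁻¹ - φ ζ * (z - ctr δ (idx δ ζ))⁻¹ :=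
    hBi.mono' ((hφ.aestronglyMeasurable.mul hmeas2.aestronglyMeasurable).sub
      (hφ.aestronglyMeasurable.mul hmeas.aestronglyMeasurable)) hae
  have hi1 : Integrable fun ζ => φ ζ * (z - ζ)⁻¹ := by
    refine (hiD.add hi2).congr (Eventually.of_forall fun ζ => ?_)
    simp
  rw [← integral_sub hi1 hi2]
  refine (norm_integral_le_of_norm_le hBi hae).trans ?_
  rw [hBv]
  have s1 : M * (4 * (2 * Real.pi * ρ)) = η / 2 := by
    rw [hρ]; field_simp; ring
  have s2 : M * (5 * δ / ρ ^ 2 * V) ≤ η / 2 := by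
    rw [le_div_iff₀ (by positivity)] at hδ₀
    have e : M * (5 * δ / ρ ^ 2 * V) = (5 * δ * M * V) / ρ ^ 2 := by ring
    rw [e, div_le_iff₀ (by positivity)]
    have : 0 ≤ δ * M := by positivity
    nlinarith
  linarith

theorem tendsto_mul_inv_sub (c : ℂ) :
    Tendsto (fun z : ℂ => z * (z - c)⁻¹) (cobounded ℂ) (𝓝 1) := by
  have h1 : Tendsto (fun z : ℂ => 1 + c * (z - c)⁻¹) (cobounded ℂ) (𝓝 (1 + c * 0)) :=
    tendsto_const_nhds.add (tendsto_const_nhds.mul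
      (tendsto_inv₀_cobounded.comp (tendsto_sub_const_cobounded c)))
  rw [mul_zero, add_zero] at h1
  refine h1.congr' ?_
  have : ∀ᶠ z in cobounded ℂ, z ≠ c := by
    have := (tendsto_norm_cobounded_atTop (E := ℂ)).eventually_gt_atTop ‖c‖
    filter_upwards [this] with z hz h
    rw [h] at hz; exact lt_irrefl _ hz
  filter_upwards [this] with z hz
  have : z - c ≠ 0 := sub_ne_zero.2 hz
  field_simp
  ring

theorem isBounded_disks (J : Finset (ℤ × ℤ)) (c : ℤ × ℤ → ℂ) (r : ℝ) :
    IsBounded (⋃ j ∈ J, closedBall (c j) r) :=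
  (isBounded_biUnion_finset J).2 fun _ _ => isBounded_closedBall

theorem disk_approx {K : Set ℂ} {f : ℂ → ℂ} {l w : ℂ} (hK : IsCompact K) {ε η : ℝ}
    (hε : 0 < ε) (hη : 0 < η) (h : Adm K f l w) :
    ∃ δ > 0, δ ≤ ε ∧ ∀ J : Finset (ℤ × ℤ), idx δ '' cthickening ε K ⊆ J →
      ‖w‖ ≤ (1 + η) * analyticCapacity (⋃ j ∈ J, closedBall (ctr δ j) (δ / 4)) := by
  obtain ⟨F, hF, hF1, hinf, hcs, hsupp⟩ := exists_smooth hK hε h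
  obtain ⟨hrep, hw⟩ := cauchy_rep hF hcs hinf
  have hcont : Continuous (dbar F) := by
    have h1 : Continuous (fderiv ℝ F) := hF.continuous_fderiv (by norm_num)
    unfold dbar
    fun_prop
  have hint : Integrable (dbar F) := hcont.integrable_of_hasCompactSupport hcs
  have hS : IsCompact (cthickening ε K) := hK.cthickening
  obtain ⟨δ₀, hδ₀, hd⟩ := discretize hcont hS hsupp hη
  refine ⟨min δ₀ ε, lt_min hδ₀ hε, min_le_right _ _, ?_⟩
  intro J hJ
  set δ := min δ₀ ε with hδdef
  have hδ : 0 < δ := lt_min hδ₀ hε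
  have hd := hd δ hδ (min_le_left _ _) J hJ
  set A : ℤ × ℤ → ℂ := fun j => ∫ ζ in idx δ ⁻¹' {j}, dbar F ζ with hA
  set g : ℂ → ℂ := fun z => l + (2 * Real.pi : ℂ)⁻¹ * ∑ j ∈ J, A j * (z - ctr δ j)⁻¹ with hg
  set D := ⋃ j ∈ J, closedBall (ctr δ j) (δ / 4) with hD
  have hfar : ∀ z ∈ Dᶜ, ∀ j ∈ J, δ / 4 ≤ ‖z - ctr δ j‖ := by
    intro z hz j hj
    by_contra hlt
    apply hz
    refine mem_biUnion hj ?_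
    rw [mem_closedBall, dist_eq_norm]
    linarith
  have hpi : ‖(2 * Real.pi : ℂ)⁻¹‖ ≤ 1 := by
    have h3 := Real.pi_gt_three
    rw [norm_inv, norm_mul, Complex.norm_real, Real.norm_of_nonneg Real.pi_pos.le]
    apply inv_le_one_of_one_le₀
    norm_num
    linarith
  have hgb : ∀ z ∈ Dᶜ, ‖g z‖ ≤ 1 + η := by
    intro z hz
    have e : g z = F z - (2 * Real.pi : ℂ)⁻¹ * ((∫ ζ, dbar F ζ * (z - ζ)⁻¹) -
        ∑ j ∈ J, A j * (z - ctr δ j)⁻¹) := by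
      rw [hrep z, hg]; ring
    rw [e]
    refine (norm_sub_le _ _).trans ?_
    refine add_le_add (hF1 z) ?_
    rw [norm_mul]
    calc _ ≤ 1 * η := mul_le_mul hpi (hd z (hfar z hz)) (norm_nonneg _) zero_le_one
      _ = η := one_mul _
  have hsum : ∑ j ∈ J, A j = ∫ ζ, dbar F ζ := by
    have := sum_squares (δ := δ) hint J (fun ζ hζ => hJ ⟨ζ, hsupp ζ hζ, rfl⟩) (fun _ => 1)
    simpa using this
  have hgd : DifferentiableOn ℂ g Dᶜ := by
    intro z hz
    apply DifferentiableAt.differentiableWithinAt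
    refine (differentiableAt_const _).add ((differentiableAt_const _).mul ?_)
    refine DifferentiableAt.fun_sum fun j hj => ?_
    refine (differentiableAt_const _).mul (DifferentiableAt.inv (by fun_prop) ?_)
    have := hfar z hz j hj
    exact norm_pos_iff.1 (by linarith)
  have hgl : Tendsto g (cobounded ℂ) (𝓝 l) := by
    have : Tendsto g (cobounded ℂ)
        (𝓝 (l + (2 * Real.pi : ℂ)⁻¹ * ∑ j ∈ J, A j * 0)) :=
      tendsto_const_nhds.add (tendsto_const_nhds.mul (tendsto_finsetSum _ fun j _ =>
        tendsto_const_nhds.mul (tendsto_inv₀_cobounded.comp (tendsto_sub_const_cobounded _))))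
    simpa using this
  have hgw : Tendsto (fun z => z * (g z - l)) (cobounded ℂ) (𝓝 w) := by
    have h1 : Tendsto (fun z : ℂ => (2 * Real.pi : ℂ)⁻¹ *
        ∑ j ∈ J, A j * (z * (z - ctr δ j)⁻¹)) (cobounded ℂ)
        (𝓝 ((2 * Real.pi : ℂ)⁻¹ * ∑ j ∈ J, A j * 1)) :=
      tendsto_const_nhds.mul (tendsto_finsetSum _ fun j _ =>
        tendsto_const_nhds.mul (tendsto_mul_inv_sub _))
    simp only [mul_one] at h1
    rw [hsum, ← hw] at h1
    refine h1.congr fun z => ?_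
    simp only [hg, add_sub_cancel_left]
    rw [mul_left_comm, Finset.mul_sum (a := z)]
    congr 1
    exact Finset.sum_congr rfl fun j _ => by ring
  have hη1 : 0 < 1 + η := by linarith
  set a : ℂ := ((1 + η : ℝ) : ℂ)⁻¹ with ha
  have hna : ‖a‖ = (1 + η)⁻¹ := by
    rw [ha, norm_inv, Complex.norm_real, Real.norm_of_nonneg hη1.le]
  have hadm : Adm D (fun z => a * g z) (a * l) (a * w) := by
    refine ⟨hgd.const_mul a, fun z hz => ?_, ?_, ?_⟩
    · rw [norm_mul, hna, inv_mul_le_iff₀ hη1, mul_one]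
      exact hgb z hz
    · exact (hgl.const_mul a).mono_left inf_le_left
    · refine ((hgw.const_mul a).mono_left inf_le_left).congr fun z => ?_
      ring
  have := hadm.le_cap (isBounded_disks J _ _)
  rwa [norm_mul, hna, inv_mul_le_iff₀ hη1] at this

theorem iUnion_equivFin {J : Finset (ℤ × ℤ)} (c : ℤ × ℤ → ℂ) (r : ℝ) :
    (⋃ i : Fin J.card, closedBall (c (J.equivFin.symm i)) r) = ⋃ j ∈ J, closedBall (c j) r := by
  rw [J.equivFin.symm.surjective.iUnion_comp (fun j : J => closedBall (c j) r)]
  ext x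
  simp

theorem disks_subset {K : Set ℂ} {ε δ : ℝ} (hε : 0 < ε) (hδ : 0 < δ) (hδε : δ ≤ ε)
    {j : ℤ × ℤ} {ζ : ℂ} (hζ : ζ ∈ cthickening ε K) (hj : idx δ ζ = j) :
    closedBall (ctr δ j) (δ / 4) ⊆ cthickening (3 * ε) K := by
  intro x hx
  have h1 : dist x ζ ≤ 2 * ε := by
    have h2 := norm_sub_ctr_le hδ ζ
    rw [hj, ← dist_eq_norm] at h2
    have := dist_triangle_right x ζ (ctr δ j)
    rw [mem_closedBall] at hx
    linarith
  have h3 := mem_cthickening_of_dist_le x ζ (2 * ε) (cthickening ε K) hζ h1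
  have h4 := cthickening_cthickening_subset (by linarith : 0 ≤ 2 * ε) hε.le K h3
  convert h4 using 2
  ring

theorem subadd_of_disks
    (H : ∀ (r : ℝ), 0 < r → ∀ (p q : ℕ) (z : Fin p → ℂ) (w : Fin q → ℂ),
      (∀ i j : Fin p, i ≠ j → Disjoint (closedBall (z i) r) (closedBall (z j) r)) →
      (∀ i j : Fin q, i ≠ j → Disjoint (closedBall (w i) r) (closedBall (w j) r)) →
      Disjoint (⋃ i, closedBall (z i) r) (⋃ j, closedBall (w j) r) →
      analyticCapacity ((⋃ i, closedBall (z i) r) ∪ ⋃ j, closedBall (w j) r) ≤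
        analyticCapacity (⋃ i, closedBall (z i) r) +
          analyticCapacity (⋃ j, closedBall (w j) r))
    {E F : Set ℂ} (hE : IsCompact E) (hF : IsCompact F) {η : ℝ} (hη : 0 < η) :
    analyticCapacity (E ∪ F) ≤
      (1 + η) * ((analyticCapacity E + η) + (analyticCapacity F + η)) := by
  classical
  obtain ⟨ε₁, hε₁, h1⟩ := cap_outer hE hη
  obtain ⟨ε₂, hε₂, h2⟩ := cap_outer hF hη
  set ε := min ε₁ ε₂ / 3 with hεdef
  have hε : 0 < ε := by have := lt_min hε₁ hε₂; positivity
  have hle1 : 3 * ε ≤ ε₁ := by have := min_le_left ε₁ ε₂; rw [hεdef]; linarith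
  have hle2 : 3 * ε ≤ ε₂ := by have := min_le_right ε₁ ε₂; rw [hεdef]; linarith
  refine cap_le fun f l w hadm => ?_
  obtain ⟨δ, hδ, hδε, hJ⟩ := disk_approx (hE.union hF) hε hη hadm
  have hfin := finite_idx hδ (hE.union hF).cthickening.isBounded (S := cthickening ε (E ∪ F))
  have hJ := hJ hfin.toFinset (by simp)
  set J := hfin.toFinset with hJdef
  refine hJ.trans ?_
  gcongr
  set P : ℤ × ℤ → Prop := fun j => ∃ ζ ∈ cthickening ε E, idx δ ζ = j with hP
  set JE := J.filter P with hJE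
  set JF := J.filter (fun j => ¬ P j) with hJF
  have hdisj : ∀ i j : ℤ × ℤ, i ≠ j →
      Disjoint (closedBall (ctr δ i) (δ / 4)) (closedBall (ctr δ j) (δ / 4)) := by
    intro i j hij
    apply closedBall_disjoint_closedBall
    have := le_dist_ctr hδ hij
    linarith
  have hsplit : (⋃ j ∈ J, closedBall (ctr δ j) (δ / 4)) =
      (⋃ j ∈ JE, closedBall (ctr δ j) (δ / 4)) ∪ ⋃ j ∈ JF, closedBall (ctr δ j) (δ / 4) := by
    rw [← Finset.set_biUnion_union, hJE, hJF, Finset.filter_union_filter_not_eq]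
  have hH := H (δ / 4) (by positivity) JE.card JF.card
    (fun i => ctr δ (JE.equivFin.symm i)) (fun i => ctr δ (JF.equivFin.symm i))
    (fun i j hij => hdisj _ _ fun h => hij (JE.equivFin.symm.injective (Subtype.ext h)))
    (fun i j hij => hdisj _ _ fun h => hij (JF.equivFin.symm.injective (Subtype.ext h)))
    (by
      rw [iUnion_equivFin (ctr δ), iUnion_equivFin (ctr δ)]
      simp only [disjoint_iUnion_left, disjoint_iUnion_right]
      intro i hi j hj
      apply hdisj
      rintro rfl
      exact (Finset.mem_filter.1 hi).2 (Finset.mem_filter.1 hj).2)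
  rw [iUnion_equivFin (ctr δ), iUnion_equivFin (ctr δ), ← hsplit] at hH
  refine hH.trans (add_le_add ?_ ?_)
  · refine (cap_mono hE.cthickening.isBounded ?_).trans h1
    refine iUnion₂_subset fun j hj => ?_
    obtain ⟨ζ, hζ, hζj⟩ := (Finset.mem_filter.1 hj).2
    exact (disks_subset hε hδ hδε hζ hζj).trans (cthickening_mono hle1 E)
  · refine (cap_mono hF.cthickening.isBounded ?_).trans h2
    refine iUnion₂_subset fun j hj => ?_
    obtain ⟨hjJ, hjP⟩ := Finset.mem_filter.1 hj
    obtain ⟨ζ, hζ, hζj⟩ := hfin.mem_toFinset.1 hjJ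
    rw [cthickening_union] at hζ
    rcases hζ with hζ | hζ
    · exact absurd ⟨ζ, hζ, hζj⟩ hjP
    · exact (disks_subset hε hδ hδε hζ hζj).trans (cthickening_mono hle2 F)

/-- Analytic capacity is subadditive for all compact sets if and only if
it is subadditive for all disjoint compact sets `E, F` that are finite unions of
pairwise disjoint closed disks, all disks having one and the same radius. -/
theorem analyticCapacity_subadditive_iff_disks :
    (∀ E F : Set ℂ, IsCompact E → IsCompact F →
      analyticCapacity (E ∪ F) ≤ analyticCapacity E + analyticCapacity F) ↔
    (∀ (r : ℝ), 0 < r → ∀ (p q : ℕ) (z : Fin p → ℂ) (w : Fin q → ℂ),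
      (∀ i j : Fin p, i ≠ j → Disjoint (closedBall (z i) r) (closedBall (z j) r)) →
      (∀ i j : Fin q, i ≠ j → Disjoint (closedBall (w i) r) (closedBall (w j) r)) →
      Disjoint (⋃ i, closedBall (z i) r) (⋃ j, closedBall (w j) r) →
      analyticCapacity ((⋃ i, closedBall (z i) r) ∪ ⋃ j, closedBall (w j) r) ≤
        analyticCapacity (⋃ i, closedBall (z i) r) +
          analyticCapacity (⋃ j, closedBall (w j) r)) := by
  constructor
  · intro h r _ p q z w _ _ _
    exact h _ _ (isCompact_iUnion fun i => isCompact_closedBall _ _)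
      (isCompact_iUnion fun i => isCompact_closedBall _ _)
  · intro H E F hE hF
    have ht : Tendsto (fun η : ℝ => (1 + η) * ((analyticCapacity E + η) +
        (analyticCapacity F + η))) (𝓝[>] 0)
        (𝓝 ((1 + 0) * ((analyticCapacity E + 0) + (analyticCapacity F + 0)))) := by
      refine Tendsto.mono_left ?_ nhdsWithin_le_nhds
      apply Continuous.tendsto
      fun_prop
    simp only [add_zero, one_mul] at ht
    refine ge_of_tendsto ht ?_
    filter_upwards [self_mem_nhdsWithin] with η hη
    exact subadd_of_disks H hE hF hη
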